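/- For every k ≥ 0, the partial run profile r after k steps of the run of the train from o to d is a switching flow from o to its end-vertex v_r, i.e., r satisfies Kirchhoff's law with source o and target v_r as well as the parity condition. -/

import Mathlib

/-- One step of the train process: from a configuration (position, current switch
settings), the train moves along the current switch edge of its position and that
switch flips. `false` stands for the switch `s0`, `true` for `s1`. -/
def trainStep {V : Type} [DecidableEq V] (s : Bool → V → V) (st : V × (V → Bool)) :
    V × (V → Bool) :=
  (s (st.2 st.1) st.1, Function.update st.2 st.1 (!(st.2 st.1)))

/-- Configuration (position, switch settings) of the run of the train from `o` to `d`
after `k` steps; the train starts at `o` with all switches set to `s0` and the process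
stops when the train first reaches `d`. -/
def runState {V : Type} [DecidableEq V] (s : Bool → V → V) (o d : V) : ℕ → V × (V → Bool)
  | 0 => (o, fun _ => false)
  | k + 1 =>
      if (runState s o d k).1 = d then runState s o d k
      else trainStep s (runState s o d k)

/-- The partial run profile after `k` steps of the run of the train from `o` to `d`:
for each edge `(v, s b v)` (encoded by the pair `v`, `b`) the number of times the train
has traversed it during the first `k` steps. -/
def runProfile {V : Type} [DecidableEq V] (s : Bool → V → V) (o d : V) : ℕ → V → Bool → ℕ
  | 0 => fun _ _ => 0
  | k + 1 =>
      if (runState s o d k).1 = d then runProfile s o d k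
      else fun v b =>
        runProfile s o d k v b +
          if v = (runState s o d k).1 ∧ b = (runState s o d k).2 (runState s o d k).1
          then 1 else 0

/-- `f : V → Bool → ℕ` (where `f v b` is the value on the edge `(v, s b v)`) is a
switching flow from `o` to `v`: Kirchhoff's law and the parity condition hold. -/
def IsSwitchingFlow {V : Type} [Fintype V] [DecidableEq V] (s : Bool → V → V)
    (o v : V) (f : V → Bool → ℕ) : Prop :=
  (∀ u : V,
      ((∑ w : V, ∑ b : Bool, if s b w = u then (f w b : ℤ) else 0)
          - ((f u false : ℤ) + (f u true : ℤ)))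
        = (if u = v then 1 else 0) - (if u = o then 1 else 0)) ∧
  (∀ u : V, f u true ≤ f u false ∧ f u false ≤ f u true + 1)

/-- The edge `(v, s b v)` belongs to the graph of last-used edges `G*_f`. -/
def LastUsed {V : Type} (f : V → Bool → ℕ) (v : V) (b : Bool) : Prop :=
  (b = false ∧ f v false ≠ f v true) ∨ (b = true ∧ f v false = f v true ∧ 0 < f v true)

/-- Adjacency of the graph of last-used edges `G*_f`. -/
def GstarAdj {V : Type} (s : Bool → V → V) (f : V → Bool → ℕ) (u w : V) : Prop :=
  ∃ b : Bool, LastUsed f u b ∧ s b u = w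

/-- `c` is a directed cycle of the binary relation `adj`: a nonempty list of pairwise
distinct vertices with `adj` holding along the list cyclically. -/
def IsCycle {V : Type} (adj : V → V → Prop) (c : List V) : Prop :=
  c ≠ [] ∧ c.Nodup ∧
    ∀ i : Fin c.length, adj (c.get i) (c.get ⟨(i.1 + 1) % c.length, Nat.mod_lt _ i.pos⟩)

/-- At every vertex the two counts differ by the current switch setting. -/
theorem runProfile_false_eq {V : Type} [DecidableEq V] (s : Bool → V → V) (o d : V) (k : ℕ)
    (u : V) :
    runProfile s o d k u false =
      runProfile s o d k u true + if (runState s o d k).2 u then 1 else 0 := by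
  induction k with
  | zero => simp [runProfile, runState]
  | succ k ih =>
    simp only [runProfile, runState]
    split_ifs <;> simp_all [trainStep, Function.update_apply] <;> grind

/-- Traversing one more edge out of `p` increases the inflow of its head only. -/
theorem sum_inflow_add_edge {V : Type} [Fintype V] [DecidableEq V] (s : Bool → V → V)
    (f : V → Bool → ℕ) (p : V) (c : Bool) (u : V) :
    (∑ w : V, ∑ b : Bool,
        if s b w = u then ((f w b + if w = p ∧ b = c then 1 else 0 : ℕ) : ℤ) else 0)
      = (∑ w : V, ∑ b : Bool, if s b w = u then (f w b : ℤ) else 0)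
        + if s c p = u then 1 else 0 := by
  have h : ∀ w b, (if s b w = u then ((f w b + if w = p ∧ b = c then 1 else 0 : ℕ) : ℤ) else 0)
      = (if s b w = u then (f w b : ℤ) else 0)
        + if w = p then if b = c then if s c p = u then 1 else 0 else 0 else 0 := by
    intro w b
    grind
  simp only [h, Finset.sum_add_distrib]
  congr 1
  rw [Finset.sum_eq_single p (by intro w _ hw; simp [hw]) (by simp)]
  simp only [if_true, Finset.sum_ite_eq', Finset.mem_univ]

/-- Kirchhoff's law for the partial run profile. -/
theorem runProfile_kirchhoff {V : Type} [Fintype V] [DecidableEq V] (s : Bool → V → V)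
    (o d : V) (k : ℕ) (u : V) :
    (∑ w : V, ∑ b : Bool, if s b w = u then (runProfile s o d k w b : ℤ) else 0)
        - ((runProfile s o d k u false : ℤ) + (runProfile s o d k u true : ℤ))
      = (if u = (runState s o d k).1 then 1 else 0) - (if u = o then 1 else 0) := by
  induction k with
  | zero => split_ifs <;> simp_all [runProfile, runState]
  | succ k ih =>
    by_cases h : (runState s o d k).1 = d
    · simpa only [runProfile, runState, if_pos h] using ih
    · simp only [runProfile, runState, if_neg h, trainStep, sum_inflow_add_edge]
      cases (runState s o d k).2 (runState s o d k).1 <;> grind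

/-- For every `k ≥ 0`, the partial run profile after `k` steps of the
run of the train from `o` to `d` is a switching flow from `o` to its end-vertex
`(runState s o d k).1`: it satisfies Kirchhoff's law with source `o` and target the
end-vertex, as well as the parity condition. -/
theorem partial_run_profile_is_switching_flow
    {V : Type} [Fintype V] [DecidableEq V] (s : Bool → V → V) (o d : V)
    (hd0 : s false d = d) (hd1 : s true d = d) (k : ℕ) :
    IsSwitchingFlow s o (runState s o d k).1 (runProfile s o d k) := by
  refine ⟨runProfile_kirchhoff s o d k, fun u => ?_⟩
  have h := runProfile_false_eq s o d k u
  split_ifs at h <;> omega
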